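/- arXiv:1912.09365 — 4 statements merged into one kernel-verified Lean document; each statement's English description precedes it below -/
import Mathlib

section
/- The function h defined on (0, ∞) by h(x) = log((1 − e^{−x})/x) is Lipschitz continuous with constant 1/2: for all x, y > 0, |h(x) − h(y)| ≤ (1/2)·|x − y|. -/
theorem aux_upper (x : ℝ) : x * Real.exp (-x) ≤ 1 - Real.exp (-x) := by
  have h1 := Real.add_one_le_exp x
  have h2 : Real.exp (-x) * Real.exp x = 1 := by rw [← Real.exp_add]; simp
  nlinarith [Real.exp_pos (-x)]

theorem aux_lower (x : ℝ) (hx : 0 ≤ x) :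
    2 * (1 - Real.exp (-x)) ≤ x * (1 + Real.exp (-x)) := by
  have hd : ∀ t : ℝ, HasDerivAt (fun t : ℝ => t * (1 + Real.exp (-t)) - 2 * (1 - Real.exp (-t)))
      (1 - Real.exp (-t) - t * Real.exp (-t)) t := by
    intro t
    have he : HasDerivAt (fun t : ℝ => Real.exp (-t)) (Real.exp (-t) * (-1)) t :=
      (hasDerivAt_neg t).exp
    have := ((hasDerivAt_id t).mul (he.const_add 1)).sub ((he.const_sub 1).const_mul 2)
    refine this.congr_deriv ?_
    simp only [id]
    ring
  have hm : Monotone (fun t : ℝ => t * (1 + Real.exp (-t)) - 2 * (1 - Real.exp (-t))) :=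
    monotone_of_hasDerivAt_nonneg hd (fun t => by
      have := aux_upper t
      simp only [Pi.zero_apply]
      linarith)
  have := hm hx
  simp at this
  linarith

theorem h_lipschitz (x y : ℝ) (hx : 0 < x) (hy : 0 < y) :
    |Real.log ((1 - Real.exp (-x)) / x) - Real.log ((1 - Real.exp (-y)) / y)| ≤
      (1 / 2) * |x - y| := by
  have hp : ∀ t : ℝ, 0 < t → 0 < 1 - Real.exp (-t) := by
    intro t ht
    have : Real.exp (-t) < 1 := by rw [Real.exp_lt_one_iff]; linarith
    linarith
  have hd : ∀ t ∈ Set.Ioi (0 : ℝ), HasDerivWithinAt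
      (fun t : ℝ => Real.log (1 - Real.exp (-t)) - Real.log t)
      (Real.exp (-t) / (1 - Real.exp (-t)) - 1 / t) (Set.Ioi 0) t := by
    intro t ht
    have ht' : 0 < t := ht
    have he : HasDerivAt (fun t : ℝ => Real.exp (-t)) (Real.exp (-t) * (-1)) t :=
      (hasDerivAt_neg t).exp
    have := ((he.const_sub 1).log (hp t ht').ne').sub (Real.hasDerivAt_log ht'.ne')
    refine (this.congr_deriv ?_).hasDerivWithinAt
    simp
  have hb : ∀ t ∈ Set.Ioi (0 : ℝ),
      ‖Real.exp (-t) / (1 - Real.exp (-t)) - 1 / t‖ ≤ 1 / 2 := by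
    intro t ht
    have ht' : 0 < t := ht
    have h0 := hp t ht'
    have h1 := aux_upper t
    have h2 := aux_lower t ht'.le
    rw [Real.norm_eq_abs, abs_le, div_sub_div _ _ h0.ne' ht'.ne']
    constructor
    · rw [le_div_iff₀ (by positivity)]
      nlinarith
    · rw [div_le_iff₀ (by positivity)]
      nlinarith [mul_pos h0 ht']
  have := (convex_Ioi (0 : ℝ)).norm_image_sub_le_of_norm_hasDerivWithin_le hd hb
    (Set.mem_Ioi.2 hy) (Set.mem_Ioi.2 hx)
  rw [Real.log_div (hp x hx).ne' hx.ne', Real.log_div (hp y hy).ne' hy.ne']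
  simpa only [Real.norm_eq_abs] using this
end

section
/- The function h defined on (0, ∞) by h(x) = log((1 − e^{−x})/x) is convex on (0, ∞); equivalently, its derivative x ↦ e^{−x}/(1 − e^{−x}) − 1/x is nondecreasing on (0, ∞). -/
lemma aux_pos {x : ℝ} (hx : 0 < x) : 0 < 1 - Real.exp (-x) := by
  have : Real.exp (-x) < 1 := Real.exp_lt_one_iff.2 (by linarith)
  linarith

lemma aux_ineq {x : ℝ} (hx : 0 < x) : x ^ 2 * Real.exp (-x) ≤ (1 - Real.exp (-x)) ^ 2 := by
  have h1 : x / 2 ≤ Real.sinh (x / 2) := Real.self_le_sinh_iff.2 (by linarith)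
  rw [Real.sinh_eq] at h1
  have hu : 0 < Real.exp (-(x / 2)) := Real.exp_pos _
  have h2 : Real.exp (x / 2) * Real.exp (-(x / 2)) = 1 := by
    rw [← Real.exp_add]; simp
  have h3 : Real.exp (-x) = Real.exp (-(x / 2)) ^ 2 := by
    rw [sq, ← Real.exp_add]; congr 1; ring
  rw [h3, ← mul_pow]
  apply pow_le_pow_left₀ (by positivity)
  nlinarith

lemma aux_deriv {x : ℝ} (hx : 0 < x) :
    HasDerivAt (fun x : ℝ => Real.exp (-x) / (1 - Real.exp (-x)) - 1 / x)
      (1 / x ^ 2 - Real.exp (-x) / (1 - Real.exp (-x)) ^ 2) x := by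
  have hp := (aux_pos hx).ne'
  have he : HasDerivAt (fun x : ℝ => Real.exp (-x)) (-Real.exp (-x)) x := by
    simpa using (hasDerivAt_neg x).exp
  have h := (he.div (he.const_sub 1) hp).sub ((hasDerivAt_const x (1 : ℝ)).div (hasDerivAt_id x) hx.ne')
  refine h.congr_deriv ?_
  simp only [id]
  field_simp
  ring

lemma aux_deriv_log {x : ℝ} (hx : 0 < x) :
    HasDerivAt (fun x : ℝ => Real.log ((1 - Real.exp (-x)) / x))
      (Real.exp (-x) / (1 - Real.exp (-x)) - 1 / x) x := by
  have hp := (aux_pos hx).ne'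
  have he : HasDerivAt (fun x : ℝ => Real.exp (-x)) (-Real.exp (-x)) x := by
    simpa using (hasDerivAt_neg x).exp
  have h := ((he.const_sub 1).div (hasDerivAt_id x) hx.ne').log (div_ne_zero hp hx.ne')
  refine h.congr_deriv ?_
  simp only [id, Pi.div_apply]
  field_simp

theorem h_convex_and_deriv_monotone :
    ConvexOn ℝ (Set.Ioi (0 : ℝ)) (fun x : ℝ => Real.log ((1 - Real.exp (-x)) / x)) ∧
    MonotoneOn (fun x : ℝ => Real.exp (-x) / (1 - Real.exp (-x)) - 1 / x)
      (Set.Ioi (0 : ℝ)) := by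
  have hm : MonotoneOn (fun x : ℝ => Real.exp (-x) / (1 - Real.exp (-x)) - 1 / x)
      (Set.Ioi (0 : ℝ)) := by
    apply monotoneOn_of_deriv_nonneg (convex_Ioi 0)
    · exact fun x hx => (aux_deriv hx).continuousAt.continuousWithinAt
    · rw [interior_Ioi]
      exact fun x hx => (aux_deriv hx).differentiableAt.differentiableWithinAt
    · rw [interior_Ioi]
      intro x hx
      have hx' : 0 < x := hx
      rw [(aux_deriv hx).deriv, sub_nonneg, div_le_div_iff₀ (pow_pos (aux_pos hx) 2) (by positivity)]
      linarith [aux_ineq hx']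
  refine ⟨?_, hm⟩
  apply MonotoneOn.convexOn_of_deriv (convex_Ioi 0)
  · exact fun x hx => (aux_deriv_log hx).continuousAt.continuousWithinAt
  · rw [interior_Ioi]
    exact fun x hx => (aux_deriv_log hx).differentiableAt.differentiableWithinAt
  · rw [interior_Ioi]
    exact hm.congr fun x hx => (aux_deriv_log hx).deriv.symm
end

section
/- Let v_1, …, v_n > 0 and λ > 0, set v̄ = (1/n) ∑_{i=1}^n v_i and S_λ = ∑_{i=1}^n ( log((1 − e^{−2λ v_i})/(2 λ v_i)) − log((1 − e^{−2λ v̄})/(2 λ v̄)) ). Then S_λ ≤ λ ∑_{i=1}^n |v_i − v̄|. -/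
open Finset

theorem sinh_cvx : ConvexOn ℝ (Set.Ici (0:ℝ)) Real.sinh := by
  apply MonotoneOn.convexOn_of_deriv (convex_Ici 0) Real.continuous_sinh.continuousOn
    Real.differentiable_sinh.differentiableOn
  rw [Real.deriv_sinh, interior_Ici]
  intro a ha b hb hab
  rw [Set.mem_Ioi] at ha hb
  rw [Real.cosh_le_cosh, abs_of_pos ha, abs_of_pos hb]
  exact hab

theorem sinh_secant {x y : ℝ} (hx : 0 < x) (hxy : x ≤ y) :
    Real.sinh x * y ≤ Real.sinh y * x := by
  have hy : 0 < y := hx.trans_le hxy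
  have h := sinh_cvx.2 (Set.mem_Ici.2 hy.le) (Set.mem_Ici.2 (le_refl (0:ℝ)))
    (show 0 ≤ x / y by positivity)
    (show 0 ≤ 1 - x / y by rw [sub_nonneg, div_le_one hy]; exact hxy) (by ring)
  simp only [smul_eq_mul, mul_zero, add_zero, Real.sinh_zero] at h
  rw [div_mul_cancel₀ _ hy.ne', div_mul_eq_mul_div, le_div_iff₀ hy] at h
  linarith

theorem exp_secant {x y : ℝ} (hx : 0 < x) (hxy : x ≤ y) :
    (1 - Real.exp (-y)) * x ≤ (1 - Real.exp (-x)) * y := by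
  have hy : 0 < y := hx.trans_le hxy
  have h := convexOn_exp.2 (Set.mem_univ (-y)) (Set.mem_univ (0:ℝ))
    (show 0 ≤ x / y by positivity)
    (show 0 ≤ 1 - x / y by rw [sub_nonneg, div_le_one hy]; exact hxy) (by ring)
  simp only [smul_eq_mul, mul_zero, add_zero, Real.exp_zero, mul_neg] at h
  rw [div_mul_cancel₀ _ hy.ne'] at h
  have h2 := mul_le_mul_of_nonneg_right h hy.le
  have h3 : (x / y * Real.exp (-y) + (1 - x / y) * 1) * y = x * Real.exp (-y) + (y - x) := by
    field_simp
  rw [h3] at h2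
  linarith

theorem pair_bound {x y : ℝ} (hx : 0 < x) (hy : 0 < y) :
    Real.log ((1 - Real.exp (-(2 * x))) / (2 * x))
      - Real.log ((1 - Real.exp (-(2 * y))) / (2 * y)) ≤ |x - y| := by
  have key : ∀ z : ℝ, 1 - Real.exp (-(2 * z)) = 2 * (Real.exp (-z) * Real.sinh z) := by
    intro z
    have e1 : Real.exp (-(2 * z)) = Real.exp (-z) * Real.exp (-z) := by
      rw [← Real.exp_add]; ring_nf
    have e2 : Real.exp (-z) * Real.exp z = 1 := by
      rw [← Real.exp_add]; simp
    rw [Real.sinh_eq, e1]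
    linear_combination -e2
  have hpos : ∀ z : ℝ, 0 < z → 0 < (1 - Real.exp (-(2 * z))) / (2 * z) := by
    intro z hz
    have : Real.exp (-(2 * z)) < 1 := by rw [Real.exp_lt_one_iff]; linarith
    exact div_pos (by linarith) (by linarith)
  rcases le_total x y with h | h
  · rw [abs_of_nonpos (by linarith)]
    have hs := sinh_secant hx h
    have hl : ∀ z : ℝ, 0 < z → Real.log ((1 - Real.exp (-(2 * z))) / (2 * z))
        = -z + Real.log (Real.sinh z / z) := by
      intro z hz
      have hz' : 0 < Real.sinh z := Real.sinh_pos_iff.2 hz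
      rw [key, mul_div_mul_left _ _ two_ne_zero, mul_div_assoc,
        Real.log_mul (Real.exp_pos _).ne' (div_pos hz' hz).ne', Real.log_exp]
    rw [hl x hx, hl y hy]
    have : Real.log (Real.sinh x / x) ≤ Real.log (Real.sinh y / y) := by
      apply Real.log_le_log (div_pos (Real.sinh_pos_iff.2 hx) hx)
      rw [div_le_div_iff₀ hx hy]
      exact hs
    linarith
  · have hs := exp_secant (x := 2 * y) (y := 2 * x) (by linarith) (by linarith)
    have : Real.log ((1 - Real.exp (-(2 * x))) / (2 * x))
        ≤ Real.log ((1 - Real.exp (-(2 * y))) / (2 * y)) := by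
      apply Real.log_le_log (hpos x hx)
      rw [div_le_div_iff₀ (by linarith) (by linarith)]
      exact hs
    have := abs_nonneg (x - y)
    linarith

theorem balance_term_le_abs_deviation
    (n : ℕ) (hn : 1 ≤ n) (v : Fin n → ℝ) (hv : ∀ i, 0 < v i) (l : ℝ) (hl : 0 < l)
    (vbar : ℝ) (hvbar : vbar = (1 / n) * ∑ i, v i)
    (S : ℝ) (hS : S = ∑ i, (Real.log ((1 - Real.exp (-(2 * l * v i))) / (2 * l * v i))
      - Real.log ((1 - Real.exp (-(2 * l * vbar))) / (2 * l * vbar)))) :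
    S ≤ l * ∑ i, |v i - vbar| := by
  have hb : 0 < vbar := by
    rw [hvbar]
    have hn' : (0:ℝ) < n := by exact_mod_cast hn
    have : 0 < ∑ i, v i := Finset.sum_pos (fun i _ => hv i) ⟨⟨0, hn⟩, Finset.mem_univ _⟩
    positivity
  rw [hS, Finset.mul_sum]
  apply Finset.sum_le_sum
  intro i _
  have h := pair_bound (mul_pos hl (hv i)) (mul_pos hl hb)
  rw [← mul_sub, abs_mul, abs_of_pos hl] at h
  simpa only [mul_assoc] using h
end

section
/- Let v_1, …, v_n > 0 and λ > 0, set v̄ = (1/n) ∑_{i=1}^n v_i, Var(v) = (1/n) ∑_{i=1}^n (v_i − v̄)², and S_λ = ∑_{i=1}^n ( log((1 − e^{−2λ v_i})/(2 λ v_i)) − log((1 − e^{−2λ v̄})/(2 λ v̄)) ). Then S_λ ≤ n λ² Var(v) / 2. -/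
open Finset

lemma aux_k {t : ℝ} (ht : 0 < t) : 2 * (Real.exp t - 1) ≤ t * (Real.exp t + 1) := by
  have hd : ∀ x : ℝ, HasDerivAt (fun t : ℝ => t * (Real.exp t + 1) - 2 * (Real.exp t - 1))
      (1 * (Real.exp x + 1) + x * Real.exp x - 2 * Real.exp x) x := fun x =>
    ((hasDerivAt_id x).mul ((Real.hasDerivAt_exp x).add_const 1)).sub
      (((Real.hasDerivAt_exp x).sub_const 1).const_mul 2)
  have hm : Monotone (fun t : ℝ => t * (Real.exp t + 1) - 2 * (Real.exp t - 1)) := by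
    apply monotone_of_deriv_nonneg (fun x => (hd x).differentiableAt)
    intro x
    rw [(hd x).deriv]
    have h1 := Real.add_one_le_exp (-x)
    have h2 : Real.exp x * Real.exp (-x) = 1 := by rw [← Real.exp_add]; simp
    nlinarith [mul_le_mul_of_nonneg_left h1 (Real.exp_pos x).le]
  have := hm ht.le
  simp at this
  linarith

lemma aux_pos_s12 {t : ℝ} (ht : 0 < t) : 0 < Real.exp t - 1 := by
  have := Real.add_one_lt_exp ht.ne'
  linarith

lemma aux_convex : ConvexOn ℝ (Set.Ioi (0:ℝ))
    (fun t => t ^ 2 / 8 - Real.log ((1 - Real.exp (-t)) / t)) := by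
  apply convexOn_of_hasDerivWithinAt2_nonneg (convex_Ioi 0)
    (f' := fun t => t / 4 - 1 / (Real.exp t - 1) + 1 / t)
    (f'' := fun t => 1 / 4 + Real.exp t / (Real.exp t - 1) ^ 2 - 1 / t ^ 2)
  · intro t ht
    have ht : 0 < t := ht
    have h1 : 0 < 1 - Real.exp (-t) := by
      have := Real.exp_lt_exp.2 (show -t < 0 by linarith)
      rw [Real.exp_zero] at this
      linarith
    apply ContinuousAt.continuousWithinAt
    have h2 : (1 - Real.exp (-t)) / t ≠ 0 := (div_pos h1 ht).ne'
    fun_prop (disch := first | assumption | exact ht.ne')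
  · intro t ht
    rw [interior_Ioi] at ht
    have ht : 0 < t := ht
    have h1 : 0 < 1 - Real.exp (-t) := by
      have := Real.exp_lt_exp.2 (show -t < 0 by linarith)
      rw [Real.exp_zero] at this
      linarith
    have h2 : (1 - Real.exp (-t)) / t ≠ 0 := (div_pos h1 ht).ne'
    have he := aux_pos_s12 ht
    have H := (((hasDerivAt_id t).pow 2).div_const 8).sub
      (((((hasDerivAt_id t).neg.exp).const_sub 1).div (hasDerivAt_id t) ht.ne').log h2)
    apply HasDerivAt.hasDerivWithinAt
    refine H.congr_deriv ?_
    simp only [id, Pi.neg_apply, Pi.div_apply]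
    have h3 : Real.exp (-t) = (Real.exp t)⁻¹ := Real.exp_neg t
    rw [h3] at h1 ⊢
    have h4 := Real.exp_pos t
    have h5 : 1 - (Real.exp t)⁻¹ = (Real.exp t - 1) / Real.exp t := by field_simp
    rw [h5]
    field_simp
    ring
  · intro t ht
    rw [interior_Ioi] at ht
    have ht : 0 < t := ht
    have he := aux_pos_s12 ht
    have H := (((hasDerivAt_id t).div_const 4).sub
      ((hasDerivAt_const t (1:ℝ)).div ((Real.hasDerivAt_exp t).sub_const 1) he.ne')).add
      ((hasDerivAt_const t (1:ℝ)).div (hasDerivAt_id t) ht.ne')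
    apply HasDerivAt.hasDerivWithinAt
    refine H.congr_deriv ?_
    simp only [id]
    ring
  · intro t ht
    rw [interior_Ioi] at ht
    have ht : 0 < t := ht
    have he := aux_pos_s12 ht
    have hk := aux_k ht
    have : 1 / 4 + Real.exp t / (Real.exp t - 1) ^ 2 - 1 / t ^ 2 =
      ((t * (Real.exp t + 1)) ^ 2 - (2 * (Real.exp t - 1)) ^ 2)
        / (4 * (Real.exp t - 1) ^ 2 * t ^ 2) := by
      field_simp
      ring
    rw [this]
    apply div_nonneg _ (by positivity)
    have := pow_le_pow_left₀ (by positivity) hk 2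
    linarith

theorem balance_term_le_variance
    (n : ℕ) (hn : 1 ≤ n) (v : Fin n → ℝ) (hv : ∀ i, 0 < v i) (l : ℝ) (hl : 0 < l)
    (vbar : ℝ) (hvbar : vbar = (1 / n) * ∑ i, v i)
    (Varv : ℝ) (hVarv : Varv = (1 / n) * ∑ i, (v i - vbar) ^ 2)
    (S : ℝ) (hS : S = ∑ i, (Real.log ((1 - Real.exp (-(2 * l * v i))) / (2 * l * v i))
      - Real.log ((1 - Real.exp (-(2 * l * vbar))) / (2 * l * vbar)))) :
    S ≤ n * l ^ 2 * Varv / 2 := by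
  have hn0 : (0:ℝ) < n := by exact_mod_cast hn
  have J := aux_convex.map_sum_le (t := Finset.univ) (w := fun _ : Fin n => (1 / n : ℝ))
    (p := fun i => 2 * l * v i) (fun i _ => by positivity)
    (by simp [hn0.ne']) (fun i _ => by have := hv i; show 0 < 2 * l * v i; positivity)
  simp only [smul_eq_mul, ← Finset.mul_sum] at J
  have hb : (1 / n : ℝ) * (2 * l * ∑ i, v i) = 2 * l * vbar := by rw [hvbar]; ring
  rw [hb, Finset.sum_sub_distrib] at J
  have hsum : ∑ i, v i = n * vbar := by rw [hvbar]; field_simp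
  have hq : ∑ i, (v i - vbar) ^ 2 = ∑ i, v i ^ 2 - n * vbar ^ 2 := by
    simp only [sub_sq, Finset.sum_add_distrib, Finset.sum_sub_distrib, ← Finset.sum_mul,
      ← Finset.mul_sum, hsum]
    simp
    ring
  have hs : ∑ i, (2 * l * v i) ^ 2 / 8 = l ^ 2 / 2 * ∑ i, v i ^ 2 := by
    rw [Finset.mul_sum]
    exact Finset.sum_congr rfl fun i _ => by ring
  rw [hs] at J
  rw [Finset.sum_sub_distrib] at hS
  simp only [Finset.sum_const, Finset.card_univ, Fintype.card_fin, nsmul_eq_mul] at hS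
  have hV : n * l ^ 2 * Varv / 2 = l ^ 2 / 2 * (∑ i, v i ^ 2 - n * vbar ^ 2) := by
    rw [hVarv, hq]; field_simp
  rw [hV, hS]
  have J2 := mul_le_mul_of_nonneg_left J hn0.le
  rw [← mul_assoc, mul_one_div_cancel hn0.ne', one_mul] at J2
  nlinarith [J2]
end
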